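/- arXiv:0803.4047 — 7 statements merged into one kernel-verified Lean document; each statement's English description precedes it below -/
import Mathlib

section
/- Let H be a complex Hilbert space and J : H → H a bounded linear operator with adjoint J* = -J and J bijective, and let ω(u,v) = ⟨Ju, v⟩ be the associated strong symplectic form. If L and M are subspaces of H that are both isotropic (ω vanishes identically on L × L and on M × M) and transversal (L ∩ M = {0} and L + M = H), then L and M are Lagrangian: L^ω = L and M^ω = M, where X^ω = {v ∈ H : ω(x,v) = 0 for all x ∈ X}. -/
open scoped InnerProductSpace

/-- If `L` and `M` are isotropic for the form `⟪Ju, v⟫` with `J` surjective and `L ⊔ M = ⊤`, then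
`L` is its own annihilator. -/
theorem annihilator_eq_of_isotropic_of_sup_eq_top
    {H : Type*} [NormedAddCommGroup H] [InnerProductSpace ℂ H]
    {J : H →L[ℂ] H} (hJ : Function.Surjective J) {L M : Submodule ℂ H}
    (hLiso : ∀ x ∈ L, ∀ y ∈ L, ⟪J x, y⟫_ℂ = 0)
    (hMiso : ∀ x ∈ M, ∀ y ∈ M, ⟪J x, y⟫_ℂ = 0)
    (hsup : L ⊔ M = ⊤) :
    {v : H | ∀ x ∈ L, ⟪J x, v⟫_ℂ = 0} = (L : Set H) := by
  refine Set.Subset.antisymm (fun v hv => ?_) fun v hv x hx => hLiso x hx v hv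
  obtain ⟨l, hl, m, hm, rfl⟩ := Submodule.mem_sup.mp (hsup ▸ Submodule.mem_top : v ∈ L ⊔ M)
  have hLm : ∀ x ∈ L, ⟪J x, m⟫_ℂ = 0 := fun x hx => by
    simpa [inner_add_right, hLiso x hx l hl] using hv x hx
  obtain ⟨u, hu⟩ := hJ m
  obtain ⟨a, ha, b, hb, rfl⟩ := Submodule.mem_sup.mp (hsup ▸ Submodule.mem_top : u ∈ L ⊔ M)
  have hm0 : m = 0 := by
    rw [← inner_self_eq_zero (𝕜 := ℂ)]
    nth_rewrite 1 [← hu]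
    rw [map_add, inner_add_left, hLm a ha, hMiso b hb m hm, add_zero]
  simpa [hm0] using hl

/-- Transversal isotropic subspaces of the strong symplectic Hilbert space
`(H, ω)`, `ω(u,v) = ⟪Ju, v⟫`, are Lagrangian. -/
theorem transversal_isotropic_lagrangian
    {H : Type*} [NormedAddCommGroup H] [InnerProductSpace ℂ H] [CompleteSpace H]
    (J : H →L[ℂ] H) (hJskew : ContinuousLinearMap.adjoint J = -J)
    (hJbij : Function.Bijective J)
    (L M : Submodule ℂ H)
    (hLiso : ∀ x ∈ L, ∀ y ∈ L, ⟪J x, y⟫_ℂ = 0)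
    (hMiso : ∀ x ∈ M, ∀ y ∈ M, ⟪J x, y⟫_ℂ = 0)
    (hinf : L ⊓ M = ⊥) (hsup : L ⊔ M = ⊤) :
    {v : H | ∀ x ∈ L, ⟪J x, v⟫_ℂ = 0} = (L : Set H) ∧
      {v : H | ∀ x ∈ M, ⟪J x, v⟫_ℂ = 0} = (M : Set H) := by
  exact ⟨annihilator_eq_of_isotropic_of_sup_eq_top hJbij.2 hLiso hMiso hsup,
    annihilator_eq_of_isotropic_of_sup_eq_top hJbij.2 hMiso hLiso (sup_comm L M ▸ hsup)⟩
end

section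
/- Let V be a vector space over a field K and ω : V × V → K an alternating bilinear form that is nondegenerate in the weak sense that ω(v,w) = 0 for all w ∈ V implies v = 0. If L and M are subspaces of V such that ω vanishes identically on L × L and on M × M, L ∩ M = {0}, and L + M = V, then L = {v ∈ V : ω(u,v) = 0 for all u ∈ L} and M = {v ∈ V : ω(u,v) = 0 for all u ∈ M}; that is, transversal isotropic subspaces of a symplectic vector space are Lagrangian. -/
/-- If `L` and `M` are isotropic for an alternating weakly nondegenerate form and span the space,
then `L` equals its annihilator. -/
theorem coe_eq_annihilator_of_isotropic_of_sup_eq_top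
    {K V : Type*} [Field K] [AddCommGroup V] [Module K V]
    {ω : V →ₗ[K] V →ₗ[K] K} (halt : ω.IsAlt)
    (hnondeg : ∀ v : V, (∀ w : V, ω v w = 0) → v = 0)
    {L M : Submodule K V}
    (hL : ∀ x ∈ L, ∀ y ∈ L, ω x y = 0) (hM : ∀ x ∈ M, ∀ y ∈ M, ω x y = 0)
    (hsup : L ⊔ M = ⊤) :
    (L : Set V) = {v : V | ∀ u ∈ L, ω u v = 0} := by
  have decomp (w : V) : ∃ a ∈ L, ∃ b ∈ M, a + b = w :=
    Submodule.mem_sup.mp (hsup ▸ Submodule.mem_top)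
  refine Set.Subset.antisymm (fun v hv u hu => hL u hu v hv) fun v hv => ?_
  obtain ⟨l, hl, m, hm, rfl⟩ := decomp v
  have hLm : ∀ u ∈ L, ω u m = 0 := fun u hu => by
    simpa [hL u hu l hl] using hv u hu
  have hm0 : m = 0 := hnondeg m fun w => by
    obtain ⟨a, ha, b, hb, rfl⟩ := decomp w
    rw [map_add, hM m hm b hb, add_zero, ← halt.neg, hLm a ha, neg_zero]
  simpa [hm0] using hl

/-- Transversal isotropic subspaces of a (weakly nondegenerate) symplectic
vector space are Lagrangian (Booß–Zhu, Lemma 1.2). -/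
theorem transversal_isotropic_lagrangian_symplectic_vector_space
    {K V : Type*} [Field K] [AddCommGroup V] [Module K V]
    (ω : V →ₗ[K] V →ₗ[K] K)
    (halt : ∀ v : V, ω v v = 0)
    (hnondeg : ∀ v : V, (∀ w : V, ω v w = 0) → v = 0)
    (L M : Submodule K V)
    (hLiso : ∀ x ∈ L, ∀ y ∈ L, ω x y = 0)
    (hMiso : ∀ x ∈ M, ∀ y ∈ M, ω x y = 0)
    (hinf : L ⊓ M = ⊥) (hsup : L ⊔ M = ⊤) :
    (L : Set V) = {v : V | ∀ u ∈ L, ω u v = 0} ∧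
      (M : Set V) = {v : V | ∀ u ∈ M, ω u v = 0} := by
  exact ⟨coe_eq_annihilator_of_isotropic_of_sup_eq_top halt hnondeg hLiso hMiso hsup,
    coe_eq_annihilator_of_isotropic_of_sup_eq_top halt hnondeg hMiso hLiso (sup_comm L M ▸ hsup)⟩
end

section
/- Let H be a complex Hilbert space and J : H → H a bounded linear operator with adjoint J* = -J and J bijective, and let ω(u,v) = ⟨Ju, v⟩. Let L ⊆ H be a closed Lagrangian subspace (L^ω = L) and W ⊆ H a closed co-isotropic subspace (W^ω ⊆ W), and assume that L + W^ω is closed in H. Then ((L ∩ W) + W^ω)^ω ∩ W = (L ∩ W) + W^ω; that is, the symplectic reduction of the Lagrangian L by the co-isotropic subspace W is again Lagrangian in the reduced space W/W^ω. -/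
open scoped InnerProductSpace

variable {H : Type*} [NormedAddCommGroup H] [InnerProductSpace ℂ H] [CompleteSpace H]

/-- The annihilator `X^ω` of a subspace `X` with respect to the symplectic form
`ω(u,v) = ⟪Ju, v⟫` on a complex Hilbert space. -/
def symplAnn (J : H →L[ℂ] H) (X : Submodule ℂ H) : Submodule ℂ H where
  carrier := {v : H | ∀ x ∈ X, ⟪J x, v⟫_ℂ = 0}
  add_mem' ha hb := fun x hx => by
    rw [inner_add_right, ha x hx, hb x hx, add_zero]
  zero_mem' := fun x _ => inner_zero_right (𝕜 := ℂ) _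
  smul_mem' c a ha := fun x hx => by
    rw [inner_smul_right, ha x hx, mul_zero]

theorem mem_symplAnn_iff_map_mem_orthogonal {J : H →L[ℂ] H}
    (hJskew : ContinuousLinearMap.adjoint J = -J) {X : Submodule ℂ H} {v : H} :
    v ∈ symplAnn J X ↔ J v ∈ Xᗮ := by
  refine forall₂_congr fun x _ => ?_
  rw [← ContinuousLinearMap.adjoint_inner_right, hJskew, neg_apply,
    inner_neg_right, neg_eq_zero]

theorem symplAnn_sup (J : H →L[ℂ] H) (X Y : Submodule ℂ H) :
    symplAnn J (X ⊔ Y) = symplAnn J X ⊓ symplAnn J Y := by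
  ext v
  refine ⟨fun h => ⟨fun x hx => h x (le_sup_left (b := Y) hx),
    fun y hy => h y (le_sup_right (a := X) hy)⟩, fun h z hz => ?_⟩
  obtain ⟨x, hx, y, hy, rfl⟩ := Submodule.mem_sup.mp hz
  rw [map_add, inner_add_left, h.1 x hx, h.2 y hy, add_zero]

theorem symplAnn_symplAnn_of_isClosed {J : H →L[ℂ] H}
    (hJskew : ContinuousLinearMap.adjoint J = -J) (hJsurj : Function.Surjective J)
    {X : Submodule ℂ H} (hX : IsClosed (X : Set H)) :
    symplAnn J (symplAnn J X) = X := by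
  have : CompleteSpace X := hX.completeSpace_coe
  ext v
  conv_rhs => rw [← X.orthogonal_orthogonal]
  constructor
  · intro h w hw
    obtain ⟨u, rfl⟩ := hJsurj w
    exact h u ((mem_symplAnn_iff_map_mem_orthogonal hJskew).2 hw)
  · exact fun h u hu => h (J u) ((mem_symplAnn_iff_map_mem_orthogonal hJskew).1 hu)

/-- Symplectic reduction of a closed Lagrangian subspace `L` by a closed co-isotropic
subspace `W` is again Lagrangian in the reduced space `W/W^ω`:
`((L ∩ W) + W^ω)^ω ∩ W = (L ∩ W) + W^ω`. -/
theorem symplectic_reduction_lagrangian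
    (J : H →L[ℂ] H) (hJskew : ContinuousLinearMap.adjoint J = -J)
    (hJbij : Function.Bijective J)
    (L W : Submodule ℂ H) (hLclosed : IsClosed (L : Set H))
    (hWclosed : IsClosed (W : Set H))
    (hLlag : symplAnn J L = L)
    (hWcoiso : symplAnn J W ≤ W)
    (hclosed : IsClosed ((L ⊔ symplAnn J W : Submodule ℂ H) : Set H)) :
    symplAnn J ((L ⊓ W) ⊔ symplAnn J W) ⊓ W = (L ⊓ W) ⊔ symplAnn J W := by
  have hW := symplAnn_symplAnn_of_isClosed hJskew hJbij.surjective hWclosed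
  have hLW : symplAnn J (L ⊔ symplAnn J W) = L ⊓ W := by rw [symplAnn_sup, hLlag, hW]
  rw [symplAnn_sup, ← hLW,
    symplAnn_symplAnn_of_isClosed hJskew hJbij.surjective hclosed, hLW, hW, inf_assoc, inf_idem,
    sup_comm, sup_inf_assoc_of_le L hWcoiso, sup_comm]
end

section
/- Let E be a finite-dimensional complex inner product space and b : E → E a linear endomorphism with adjoint b†. Then the orthogonal complement of the sum of the generalized eigenspaces of b over all eigenvalues λ with Re λ ≥ 0 equals the sum of the generalized eigenspaces of b† over all eigenvalues μ with Re μ < 0: (⨆_{Re λ ≥ 0} genEig(b,λ))^⊥ = ⨆_{Re μ < 0} genEig(b†,μ). -/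
open Module

/-- Vectors annihilated by a power of `f - μ` lie in the range of every power of `f - ν`
when `μ ≠ ν`. -/
theorem Module.End.maxGenEigenspace_le_range_pow {K V : Type*} [Field K] [AddCommGroup V]
    [Module K V] (f : End K V) {μ ν : K} (h : μ ≠ ν) (k : ℕ) :
    f.maxGenEigenspace μ ≤ LinearMap.range ((f - ν • (1 : End K V)) ^ k) := by
  intro x hx
  obtain ⟨n, hn⟩ := (f.mem_maxGenEigenspace μ x).1 hx
  have haeval : ∀ c : K, Polynomial.aeval f (Polynomial.X - Polynomial.C c) =
      f - c • (1 : End K V) := fun c => by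
    simp [Algebra.algebraMap_eq_smul_one]
  obtain ⟨p, q, hpq⟩ :=
    (Polynomial.isCoprime_X_sub_C_of_isUnit_sub (sub_ne_zero.2 h).isUnit).pow (m := n) (n := k)
  have hx' := congrArg (fun r => Polynomial.aeval f r x) hpq
  rw [mul_comm q] at hx'
  simp only [map_add, map_mul, map_pow, haeval, map_one, LinearMap.add_apply,
    Module.End.mul_apply, hn, map_zero, zero_add, Module.End.one_apply] at hx'
  exact ⟨_, hx'⟩

/-- Generalized eigenspaces of `b` and of its adjoint are orthogonal unless the eigenvalues are
conjugate to each other. -/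
theorem Module.End.maxGenEigenspace_isOrtho_adjoint {𝕜 E : Type*} [RCLike 𝕜]
    [NormedAddCommGroup E] [InnerProductSpace 𝕜 E] [FiniteDimensional 𝕜 E]
    (b : E →ₗ[𝕜] E) {l m : 𝕜} (h : m ≠ star l) :
    Module.End.maxGenEigenspace b l ⟂ Module.End.maxGenEigenspace (LinearMap.adjoint b) m := by
  rw [Submodule.isOrtho_iff_inner_eq]
  intro v hv x hx
  obtain ⟨k, hk⟩ := (Module.End.mem_maxGenEigenspace b l v).1 hv
  obtain ⟨y, rfl⟩ := Module.End.maxGenEigenspace_le_range_pow _ h k hx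
  have hadj : (LinearMap.adjoint b - star l • (1 : End 𝕜 E)) ^ k =
      LinearMap.adjoint ((b - l • (1 : End 𝕜 E)) ^ k) := by
    simp only [← LinearMap.star_eq_adjoint, star_pow, star_sub, star_smul, star_one]
  rw [hadj, LinearMap.adjoint_inner_right, hk, inner_zero_left]

/-- The orthogonal complement of the sum of the generalized eigenspaces of `b` over
eigenvalues with nonnegative real part is the sum of the generalized eigenspaces of the
adjoint `b†` over eigenvalues with negative real part:
`(im P₊(b))^⊥ = im P₋(b*)`. -/
theorem orthogonal_genEigenspaces_adjoint
    {E : Type*} [NormedAddCommGroup E] [InnerProductSpace ℂ E] [FiniteDimensional ℂ E]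
    (b : E →ₗ[ℂ] E) :
    (⨆ l : {l : ℂ // 0 ≤ l.re}, Module.End.maxGenEigenspace b (l : ℂ))ᗮ =
      ⨆ m : {m : ℂ // m.re < 0}, Module.End.maxGenEigenspace (LinearMap.adjoint b) (m : ℂ) := by
  have hsplit : ∀ f : End ℂ E, (⨆ l : {l : ℂ // 0 ≤ l.re}, f.maxGenEigenspace (l : ℂ)) ⊔
      (⨆ l : {l : ℂ // l.re < 0}, f.maxGenEigenspace (l : ℂ)) = ⊤ := fun f => by
    rw [eq_top_iff, ← Module.End.iSup_maxGenEigenspace_eq_top f]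
    refine iSup_le fun l => ?_
    rcases le_or_gt 0 l.re with hl | hl
    · exact le_sup_of_le_left
        (le_iSup (fun l : {l : ℂ // 0 ≤ l.re} => f.maxGenEigenspace (l : ℂ)) ⟨l, hl⟩)
    · exact le_sup_of_le_right
        (le_iSup (fun l : {l : ℂ // l.re < 0} => f.maxGenEigenspace (l : ℂ)) ⟨l, hl⟩)
  have hre : ∀ {l m : ℂ}, m.re ≠ l.re → m ≠ star l := fun h e => h (by simp [e])
  have hneg : (⨆ m : {m : ℂ // m.re < 0},
      Module.End.maxGenEigenspace (LinearMap.adjoint b) (m : ℂ)) ≤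
      (⨆ l : {l : ℂ // 0 ≤ l.re}, Module.End.maxGenEigenspace b (l : ℂ))ᗮ := by
    rw [← Submodule.isOrtho_iff_le, Submodule.isOrtho_iSup_left]
    refine fun m => Submodule.isOrtho_iSup_right.2 fun l => ?_
    exact (Module.End.maxGenEigenspace_isOrtho_adjoint b
      (hre (m.2.trans_le l.2).ne)).symm
  have hnonneg : (⨆ m : {m : ℂ // 0 ≤ m.re},
      Module.End.maxGenEigenspace (LinearMap.adjoint b) (m : ℂ)) ≤
      (⨆ l : {l : ℂ // l.re < 0}, Module.End.maxGenEigenspace b (l : ℂ))ᗮ := by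
    rw [← Submodule.isOrtho_iff_le, Submodule.isOrtho_iSup_left]
    refine fun m => Submodule.isOrtho_iSup_right.2 fun l => ?_
    exact (Module.End.maxGenEigenspace_isOrtho_adjoint b
      (hre (l.2.trans_le m.2).ne')).symm
  refine le_antisymm (fun x hx => ?_) hneg
  obtain ⟨p, hp, n, hn, rfl⟩ := Submodule.mem_sup.1
    ((hsplit (LinearMap.adjoint b)).symm ▸ Submodule.mem_top : x ∈ _)
  have hp0 : p ∈ (⊤ : Submodule ℂ E)ᗮ := by
    rw [← hsplit b, ← Submodule.inf_orthogonal]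
    exact ⟨by simpa using Submodule.sub_mem _ hx (hneg hn), hnonneg hp⟩
  rw [Submodule.top_orthogonal_eq_bot, Submodule.mem_bot] at hp0
  rwa [hp0, zero_add]
end

section
/- Let E be a finite-dimensional complex inner product space, b : E → E a linear endomorphism with adjoint b†, and S : E → E a self-adjoint linear map with ⟨Sx, x⟩ > 0 for every x ≠ 0. Let V₊ = ⨆_{Re λ ≥ 0} genEig(b,λ) and V₋ = ⨆_{Re μ < 0} genEig(b†,μ). Then the linear map V₊ × V₋ → E given by (e₊, e₋) ↦ −S e₊ + e₋ is bijective. -/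
open scoped InnerProductSpace
open Module

open Polynomial in
/-- Generalized eigenspaces of `b` and `b†` for `l` and `m` are orthogonal unless `l = conj m`. -/
theorem Module.End.isOrtho_maxGenEigenspace_adjoint
    {E : Type*} [NormedAddCommGroup E] [InnerProductSpace ℂ E] [FiniteDimensional ℂ E]
    (b : E →ₗ[ℂ] E) {l m : ℂ} (hlm : l ≠ starRingEnd ℂ m) :
    Module.End.maxGenEigenspace b l ⟂ Module.End.maxGenEigenspace (LinearMap.adjoint b) m := by
  rw [Submodule.isOrtho_iff_inner_eq]
  intro x hx y hy
  obtain ⟨k, hk⟩ := (Module.End.mem_maxGenEigenspace _ _ _).1 hx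
  obtain ⟨j, hj⟩ := (Module.End.mem_maxGenEigenspace _ _ _).1 hy
  obtain ⟨u, v, huv⟩ :=
    (isCoprime_X_sub_C_of_isUnit_sub (sub_ne_zero.2 hlm).isUnit).pow (m := k) (n := j)
  have hX (c : ℂ) : aeval b (X - C c) = b - c • (1 : Module.End ℂ E) := by
    simp [Algebra.algebraMap_eq_smul_one]
  have hx' : x = ((b - starRingEnd ℂ m • (1 : Module.End ℂ E)) ^ j) (aeval b v x) := by
    have h := congrArg (fun p => aeval b p x) huv
    rw [mul_comm v] at h
    simp only [map_add, map_mul, map_pow, hX, map_one, LinearMap.add_apply,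
      Module.End.mul_apply, hk, map_zero, zero_add, Module.End.one_apply] at h
    exact h.symm
  have hadj : LinearMap.adjoint ((b - starRingEnd ℂ m • (1 : Module.End ℂ E)) ^ j) =
      (LinearMap.adjoint b - m • (1 : Module.End ℂ E)) ^ j := by
    simp only [← LinearMap.star_eq_adjoint, star_pow, star_sub, star_smul, star_one]
    simp
  rw [hx', ← LinearMap.adjoint_inner_right, hadj, hj, inner_zero_right]

/-- If every scalar satisfies `p` or `q`, the dimensions of the sums of the generalized eigenspaces
for the scalars with `p` and for those with `q` add up to at least the dimension of the space. -/
theorem Module.End.finrank_le_add_finrank_iSup_maxGenEigenspace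
    {K V : Type*} [Field K] [IsAlgClosed K] [AddCommGroup V] [Module K V] [FiniteDimensional K V]
    (b : Module.End K V) (p q : K → Prop) (hpq : ∀ l, p l ∨ q l) :
    finrank K V ≤ finrank K ↥(⨆ l : {l // p l}, Module.End.maxGenEigenspace b (l : K)) +
      finrank K ↥(⨆ l : {l // q l}, Module.End.maxGenEigenspace b (l : K)) := by
  rw [← finrank_top K V, ← Module.End.iSup_maxGenEigenspace_eq_top b]
  refine le_trans (Submodule.finrank_mono ?_) (Submodule.finrank_add_le_finrank_add_finrank _ _)
  refine iSup_le fun l => ?_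
  rcases hpq l with h | h
  · exact le_sup_of_le_left
      (le_iSup (fun l : {l // p l} => Module.End.maxGenEigenspace b (l : K)) ⟨l, h⟩)
  · exact le_sup_of_le_right
      (le_iSup (fun l : {l // q l} => Module.End.maxGenEigenspace b (l : K)) ⟨l, h⟩)

theorem Submodule.IsOrtho.finrank_add_finrank_le
    {𝕜 E : Type*} [RCLike 𝕜] [NormedAddCommGroup E] [InnerProductSpace 𝕜 E]
    [FiniteDimensional 𝕜 E] {U V : Submodule 𝕜 E} (h : U ⟂ V) :
    finrank 𝕜 U + finrank 𝕜 V ≤ finrank 𝕜 E := by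
  rw [← Submodule.finrank_add_finrank_orthogonal V, add_comm]
  gcongr
  exact Submodule.finrank_mono h

/-- If `U ⟂ V` have complementary dimensions and `S` is positive definite on `U`, then
`U × V → E`, `(u, v) ↦ -S u + v`, is bijective. -/
theorem Submodule.IsOrtho.bijective_neg_add
    {E : Type*} [NormedAddCommGroup E] [InnerProductSpace ℂ E] [FiniteDimensional ℂ E]
    {U V : Submodule ℂ E} (h : U ⟂ V) (hdim : finrank ℂ U + finrank ℂ V = finrank ℂ E)
    (S : E →ₗ[ℂ] E) (hS : ∀ x ∈ U, x ≠ 0 → 0 < (⟪S x, x⟫_ℂ).re) :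
    Function.Bijective (fun p : U × V => -S (p.1 : E) + (p.2 : E)) := by
  let f : (U × V) →ₗ[ℂ] E := (-(S ∘ₗ U.subtype)).coprod V.subtype
  have hf : Function.Injective f := by
    rw [← LinearMap.ker_eq_bot, LinearMap.ker_eq_bot']
    rintro ⟨u, v⟩ huv
    have hv : (v : E) = S u :=
      (by simpa [f, neg_add_eq_zero] using huv : S u = v).symm
    have hu : (u : E) = 0 := by
      by_contra hu
      have := hS u u.2 hu
      rw [← hv, Submodule.isOrtho_iff_inner_eq.1 h.symm v v.2 u u.2] at this
      simp at this
    have hv0 : (v : E) = 0 := by rw [hv, hu, map_zero]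
    exact Prod.ext (Subtype.ext hu) (Subtype.ext hv0)
  exact ⟨hf, (LinearMap.injective_iff_surjective_of_finrank_eq_finrank
    (by rw [Module.finrank_prod, hdim])).1 hf⟩

/-- The Šapiro–Lopatinskiĭ condition for the invertible double: with
`V₊ = ⨆_{Re λ ≥ 0} genEig(b,λ)` and `V₋ = ⨆_{Re μ < 0} genEig(b†,μ)` and `S`
self-adjoint positive definite, the map `V₊ × V₋ → E`, `(e₊,e₋) ↦ -S e₊ + e₋`,
is bijective. -/
theorem shapiro_lopatinskii_condition_invertible_double
    {E : Type*} [NormedAddCommGroup E] [InnerProductSpace ℂ E] [FiniteDimensional ℂ E]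
    (b : E →ₗ[ℂ] E) (S : E →ₗ[ℂ] E) (hSsym : S.IsSymmetric)
    (hSpos : ∀ x : E, x ≠ 0 → 0 < (⟪S x, x⟫_ℂ).re) :
    Function.Bijective
      (fun p : ↥(⨆ l : {l : ℂ // 0 ≤ l.re}, Module.End.maxGenEigenspace b (l : ℂ)) ×
          ↥(⨆ m : {m : ℂ // m.re < 0},
            Module.End.maxGenEigenspace (LinearMap.adjoint b) (m : ℂ)) =>
        -S (p.1 : E) + (p.2 : E)) := by
  have hortho (p q : ℂ → Prop) (hpq : ∀ l m, p l → q m → l ≠ starRingEnd ℂ m) :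
      (⨆ l : {l // p l}, Module.End.maxGenEigenspace b (l : ℂ)) ⟂
        ⨆ m : {m // q m}, Module.End.maxGenEigenspace (LinearMap.adjoint b) (m : ℂ) :=
    Submodule.isOrtho_iSup_left.2 fun l => Submodule.isOrtho_iSup_right.2 fun m =>
      Module.End.isOrtho_maxGenEigenspace_adjoint b (hpq l m l.2 m.2)
  have h₁ := hortho (fun l => 0 ≤ l.re) (fun m => m.re < 0) (by
    rintro _ m hl hm rfl
    exact not_lt.2 hl hm)
  have h₂ := hortho (fun l => l.re < 0) (fun m => 0 ≤ m.re) (by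
    rintro _ m hl hm rfl
    exact not_lt.2 hm hl)
  have hb := Module.End.finrank_le_add_finrank_iSup_maxGenEigenspace b
    (fun l => 0 ≤ l.re) (fun l => l.re < 0) (fun l => le_or_gt 0 l.re)
  have hb' := Module.End.finrank_le_add_finrank_iSup_maxGenEigenspace (LinearMap.adjoint b)
    (fun l => 0 ≤ l.re) (fun l => l.re < 0) (fun l => le_or_gt 0 l.re)
  have hd₁ := h₁.finrank_add_finrank_le
  have hd₂ := h₂.finrank_add_finrank_le
  exact h₁.bijective_neg_add (by omega) S fun x _ => hSpos x
end

section
/- Let H be a complex Hilbert space, D_m ⊆ H a dense subspace, and (A_s)_{s ∈ [0,1]} a family of linear operators A_s : D_m → H, each symmetric (⟨A_s x, y⟩ = ⟨x, A_s y⟩ for all x, y ∈ D_m) and closed (graph closed in H × H). Assume the adjoints A_s† all have the same domain D_max ⊇ D_m, and that s ↦ A_s† is continuous as a map from [0,1] into the bounded operators from D_max to H, where D_max carries the graph norm (‖x‖² + ‖A_0† x‖²)^{1/2} of A_0†. Assume A_0 is injective on D_m (weak inner UCP), and that there exists a subspace D with D_m ⊆ D ⊆ D_max such that the restriction A_0†|_D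 is self-adjoint (equal to its own adjoint as an unbounded operator) and Fredholm (finite-dimensional kernel, closed range of finite codimension). Then there exists ε > 0 such that for all s < ε the operator A_s† : D_max → H is surjective and A_s is injective on D_m, i.e., A_s satisfies weak inner UCP. -/
open scoped InnerProductSpace

section ClosedOperators

variable {H : Type*} [NormedAddCommGroup H] [InnerProductSpace ℂ H] [CompleteSpace H]

/-- A pair orthogonal to the orthogonal complement of a closed graph lies on the graph. -/
lemma exists_eq_prod_of_isClosed_graph {D : Submodule ℂ H} (T : D →ₗ[ℂ] H)
    (hT : IsClosed {p : H × H | ∃ x : D, p = ((x : H), T x)}) (u v : H)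
    (huv : ∀ a b : H, (∀ x : D, ⟪(x : H), a⟫_ℂ + ⟪T x, b⟫_ℂ = 0) →
      ⟪a, u⟫_ℂ + ⟪b, v⟫_ℂ = 0) :
    ∃ x : D, (u, v) = ((x : H), T x) := by
  let K : Submodule ℂ (WithLp 2 (H × H)) :=
    LinearMap.range ((WithLp.linearEquiv 2 ℂ (H × H)).symm.toLinearMap ∘ₗ D.subtype.prod T)
  have hK : IsClosed (K : Set (WithLp 2 (H × H))) := by
    convert hT.preimage (WithLp.prod_continuous_ofLp 2 H H) using 1
    ext p
    simp only [K, SetLike.mem_coe, LinearMap.mem_range, Set.mem_preimage, Set.mem_ofPred_eq]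
    refine exists_congr fun x => ⟨fun h => by rw [← h]; rfl, fun h => ?_⟩
    exact (WithLp.linearEquiv 2 ℂ (H × H)).injective h.symm
  have hmem : WithLp.toLp 2 (u, v) ∈ Kᗮᗮ := by
    rw [Submodule.mem_orthogonal]
    intro p hp
    rw [WithLp.prod_inner_apply]
    refine huv _ _ fun x => ?_
    have := (Submodule.mem_orthogonal _ _).1 hp _ (LinearMap.mem_range_self _ x)
    rwa [WithLp.prod_inner_apply] at this
  rw [Submodule.orthogonal_orthogonal_eq_closure, hK.submodule_topologicalClosure_eq] at hmem
  obtain ⟨x, hx⟩ := hmem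
  exact ⟨x, (congrArg WithLp.ofLp hx).symm⟩

/-- An injective operator with a surjective formal adjoint is bounded below. -/
lemma exists_norm_le_of_surjective_formalAdjoint {D E : Submodule ℂ H} (T : D →ₗ[ℂ] H)
    (S : E →ₗ[ℂ] H) (hTS : ∀ (y : E) (x : D), ⟪T x, (y : H)⟫_ℂ = ⟪(x : H), S y⟫_ℂ)
    (hT : ∀ x, T x = 0 → x = 0) (hS : Function.Surjective S) :
    ∃ C > (0 : ℝ), ∀ x : D, ‖(x : H)‖ ≤ C * ‖T x‖ := by
  let g : D → H →L[ℂ] ℂ := fun x => innerSL ℂ (((‖T x‖⁻¹ : ℝ) : ℂ) • (x : H))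
  obtain ⟨C, hC⟩ := banach_steinhaus (g := g) (fun z => by
    obtain ⟨y, rfl⟩ := hS z
    refine ⟨‖(y : H)‖, fun x => ?_⟩
    simp only [g, innerSL_apply_apply, inner_smul_left, Complex.conj_ofReal, ← hTS, norm_mul,
      Complex.norm_real, norm_inv, norm_norm]
    rcases eq_or_ne (T x) 0 with h | h
    · simp [h]
    · rw [inv_mul_le_iff₀ (norm_pos_iff.2 h)]
      exact norm_inner_le_norm _ _)
  refine ⟨|C| + 1, by positivity, fun x => ?_⟩
  rcases eq_or_ne (T x) 0 with h | h
  · simp [hT x h]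
  · have h1 := hC x
    simp only [g, innerSL_apply_norm, norm_smul, Complex.norm_real, norm_inv, norm_norm] at h1
    rw [inv_mul_le_iff₀ (norm_pos_iff.2 h)] at h1
    nlinarith [le_abs_self C, norm_nonneg (T x)]

/-- For an operator bounded below, the weak adjoint equation is always solvable. -/
lemma exists_inner_eq_of_norm_le {D : Submodule ℂ H} (T : D →ₗ[ℂ] H) (C : ℝ)
    (hT : ∀ x : D, ‖(x : H)‖ ≤ C * ‖T x‖) (z : H) :
    ∃ y : H, ∀ x : D, ⟪T x, y⟫_ℂ = ⟪(x : H), z⟫_ℂ := by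
  have hinj : Function.Injective T := by
    refine (injective_iff_map_eq_zero T).2 fun x hx => ?_
    have := hT x
    simpa [hx] using this
  let e := LinearEquiv.ofInjective T hinj
  let f : LinearMap.range T →ₗ[ℂ] ℂ :=
    (innerSL ℂ z).toLinearMap ∘ₗ D.subtype ∘ₗ e.symm.toLinearMap
  have hf : ∀ w, ‖f w‖ ≤ (‖z‖ * C) * ‖w‖ := fun w => by
    obtain ⟨x, rfl⟩ := e.surjective w
    have h1 : ‖f (e x)‖ ≤ ‖z‖ * ‖(x : H)‖ := by
      simpa [f] using norm_inner_le_norm z (x : H)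
    have h2 : ‖e x‖ = ‖T x‖ := rfl
    rw [h2, mul_assoc]
    exact h1.trans (mul_le_mul_of_nonneg_left (hT x) (norm_nonneg z))
  obtain ⟨F, hF, -⟩ := exists_extension_norm_eq _ (f.mkContinuous _ hf)
  refine ⟨(InnerProductSpace.toDual ℂ H).symm F, fun x => ?_⟩
  rw [← inner_conj_symm, InnerProductSpace.toDual_symm_apply, ← inner_conj_symm (x : H) z]
  have := hF (e x)
  congr 1
  simpa [f, e] using this

end ClosedOperators

/-- Stability of weak inner UCP under small perturbations (Booß–Zhu, Lemma 4.5):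
given a family `A_s : D_m → H` of closed symmetric operators with common minimal domain
`D_m` and common maximal (adjoint) domain `D_max`, such that `s ↦ A_s†` is continuous
into the bounded operators from `(D_max, graph norm of A_0†)` to `H`, if `A_0` is
injective (weak inner UCP) and `A_0†` admits a self-adjoint Fredholm restriction to some
intermediate domain `D`, then for all small `s` the operator `A_s†` is surjective and
`A_s` is injective, i.e. satisfies weak inner UCP. -/
theorem weak_inner_UCP_stability
    {H : Type*} [NormedAddCommGroup H] [InnerProductSpace ℂ H] [CompleteSpace H]
    (Dm Dmax : Submodule ℂ H) (hdense : Dense (Dm : Set H)) (hsub : Dm ≤ Dmax)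
    (A : ℝ → (Dm →ₗ[ℂ] H)) (A' : ℝ → (Dmax →ₗ[ℂ] H))
    -- each `A s` is symmetric
    (hsym : ∀ s ∈ Set.Icc (0:ℝ) 1, ∀ x y : Dm, ⟪A s x, (y : H)⟫_ℂ = ⟪(x : H), A s y⟫_ℂ)
    -- each `A s` is closed (its graph is closed in `H × H`)
    (hclosed : ∀ s ∈ Set.Icc (0:ℝ) 1,
      IsClosed {p : H × H | ∃ x : Dm, p = ((x : H), A s x)})
    -- `A' s` is the Hilbert space adjoint of `A s`, with domain exactly `Dmax`
    (hadj : ∀ s ∈ Set.Icc (0:ℝ) 1, ∀ (y : Dmax) (x : Dm),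
      ⟪A s x, (y : H)⟫_ℂ = ⟪(x : H), A' s y⟫_ℂ)
    (hadj_dom : ∀ s ∈ Set.Icc (0:ℝ) 1, ∀ y z : H,
      (∀ x : Dm, ⟪A s x, y⟫_ℂ = ⟪(x : H), z⟫_ℂ) → y ∈ Dmax)
    -- each `A' s` is bounded w.r.t. the graph norm of `A' 0` on `Dmax`,
    -- and `s ↦ A' s` is continuous into the bounded operators `(Dmax, graph norm) → H`
    (hbound : ∀ s ∈ Set.Icc (0:ℝ) 1, ∃ c : ℝ, ∀ y : Dmax,
      ‖A' s y‖ ≤ c * Real.sqrt (‖(y : H)‖ ^ 2 + ‖A' 0 y‖ ^ 2))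
    (hcont : ∀ s₀ ∈ Set.Icc (0:ℝ) 1, ∀ ε > (0:ℝ), ∃ δ > (0:ℝ),
      ∀ s ∈ Set.Icc (0:ℝ) 1, |s - s₀| < δ → ∀ y : Dmax,
        ‖A' s y - A' s₀ y‖ ≤ ε * Real.sqrt (‖(y : H)‖ ^ 2 + ‖A' 0 y‖ ^ 2))
    -- weak inner UCP for `A 0`
    (hUCP0 : ∀ x : Dm, A 0 x = 0 → x = 0)
    -- existence of a self-adjoint Fredholm extension `A' 0 |_D` with `Dm ⊆ D ⊆ Dmax`
    (hD : ∃ (D : Submodule ℂ H) (_ : Dm ≤ D) (hDmax : D ≤ Dmax),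
      (∀ y z : D, ⟪(A' 0 ∘ₗ Submodule.inclusion hDmax) y, (z : H)⟫_ℂ =
          ⟪(y : H), (A' 0 ∘ₗ Submodule.inclusion hDmax) z⟫_ℂ) ∧
      (∀ u v : H,
        (∀ y : D, ⟪(A' 0 ∘ₗ Submodule.inclusion hDmax) y, u⟫_ℂ = ⟪(y : H), v⟫_ℂ) →
        u ∈ D) ∧
      FiniteDimensional ℂ (LinearMap.ker (A' 0 ∘ₗ Submodule.inclusion hDmax)) ∧
      IsClosed ((LinearMap.range (A' 0 ∘ₗ Submodule.inclusion hDmax) : Submodule ℂ H) :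
        Set H) ∧
      FiniteDimensional ℂ
        (H ⧸ LinearMap.range (A' 0 ∘ₗ Submodule.inclusion hDmax))) :
    ∃ ε > (0:ℝ), ∀ s ∈ Set.Icc (0:ℝ) 1, s < ε →
      Function.Surjective (A' s) ∧ ∀ x : Dm, A s x = 0 → x = 0 := by
  have h0 : (0 : ℝ) ∈ Set.Icc (0 : ℝ) 1 := ⟨le_rfl, zero_le_one⟩
  have hext : ∀ s ∈ Set.Icc (0 : ℝ) 1, ∀ x : Dm, A' s ⟨x, hsub x.2⟩ = A s x := by
    intro s hs x
    refine hdense.eq_of_inner_right ℂ fun w hw => ?_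
    rw [← hadj s hs _ ⟨w, hw⟩, ← hsym s hs ⟨w, hw⟩ x]
  have hsurj : Function.Surjective (A' 0) := by
    obtain ⟨D, -, hDmax, -, hDadj, -, hcl, hfin⟩ := hD
    rw [← LinearMap.range_eq_top]
    have hclosed_range : IsClosed ((LinearMap.range (A' 0) : Submodule ℂ H) : Set H) :=
      Submodule.isClosed_mono_of_finiteDimensional_quotient hcl (LinearMap.range_comp_le_range _ _)
    rw [← hclosed_range.submodule_topologicalClosure_eq, Submodule.topologicalClosure_eq_top_iff,
      Submodule.eq_bot_iff]
    intro u hu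
    rw [Submodule.mem_orthogonal] at hu
    obtain ⟨x, hx⟩ := exists_eq_prod_of_isClosed_graph (A 0) (hclosed 0 h0) u 0 (by
      intro a b hab
      have hb : ∀ x : Dm, ⟪A 0 x, b⟫_ℂ = ⟪(x : H), -a⟫_ℂ := fun x => by
        rw [inner_neg_right]
        linear_combination hab x
      have hbD := hadj_dom 0 h0 b (-a) hb
      have hba : A' 0 ⟨b, hbD⟩ = -a := hdense.eq_of_inner_right ℂ fun w hw => by
        rw [← hadj 0 h0 _ ⟨w, hw⟩, hb ⟨w, hw⟩]
      have := hu _ (LinearMap.mem_range_self (A' 0) ⟨b, hbD⟩)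
      rw [hba, inner_neg_left, neg_eq_zero] at this
      simp [this])
    obtain ⟨h1, h2⟩ := Prod.mk.inj hx
    rw [h1, hUCP0 x h2.symm, Submodule.coe_zero]
  obtain ⟨C, hC, hCx⟩ :=
    exists_norm_le_of_surjective_formalAdjoint (A 0) (A' 0) (hadj 0 h0) hUCP0 hsurj
  obtain ⟨δ, hδ, hδs⟩ := hcont 0 h0 (1 / (2 * (C + 1))) (by positivity)
  refine ⟨δ, hδ, fun s hs hsδ => ?_⟩
  have hbelow : ∀ x : Dm, ‖(x : H)‖ ≤ (2 * C) * ‖A s x‖ := by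
    intro x
    have h1 := hδs s hs (by rwa [sub_zero, abs_of_nonneg hs.1]) ⟨x, hsub x.2⟩
    rw [hext s hs, hext 0 h0] at h1
    have h2 : √(‖(x : H)‖ ^ 2 + ‖A 0 x‖ ^ 2) ≤ (C + 1) * ‖A 0 x‖ := by
      refine Real.sqrt_le_iff.2 ⟨by positivity, ?_⟩
      nlinarith [hCx x, norm_nonneg (x : H), norm_nonneg (A 0 x),
        mul_nonneg hC.le (sq_nonneg ‖A 0 x‖), pow_le_pow_left₀ (norm_nonneg (x : H)) (hCx x) 2]
    have h3 : ‖A s x - A 0 x‖ ≤ 1 / 2 * ‖A 0 x‖ := by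
      refine h1.trans ((mul_le_mul_of_nonneg_left h2 (by positivity)).trans_eq ?_)
      field_simp
    have h4 : ‖A 0 x‖ - ‖A s x‖ ≤ ‖A s x - A 0 x‖ := by
      rw [norm_sub_rev]
      exact norm_sub_norm_le _ _
    nlinarith [hCx x]
  refine ⟨fun z => ?_, fun x hx => ?_⟩
  · obtain ⟨y, hy⟩ := exists_inner_eq_of_norm_le (A s) _ hbelow z
    refine ⟨⟨y, hadj_dom s hs y z hy⟩, hdense.eq_of_inner_right ℂ fun w hw => ?_⟩
    rw [← hadj s hs _ ⟨w, hw⟩, hy ⟨w, hw⟩]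
  · simpa [hx] using hbelow x
end

section
/- Let a : ℝ → ℝ be a continuous function vanishing identically on (−∞, 1] with ∫₁² a(t) dt = √2. Then the function u(x) := ∫₁ˣ a(t) dt is continuously differentiable, vanishes identically on (−∞, 1], satisfies the nonlocal linear equation u′(x) = a(x) · ∫₀² u(s) a(s) ds for every x ∈ ℝ, and u(2) = √2 ≠ 0. Hence the globally perturbed linear operator u ↦ u′ − a·∫₀² u(s)a(s) ds admits a nontrivial solution vanishing on the interval [0,1], so weak unique continuation fails for it. -/
/-- Weak unique continuation fails for a rank-one global linear perturbation of `d/dx`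
(Booß–Marcolli–Wang): if `a` is continuous, vanishes on `(-∞,1]` and `∫₁² a = √2`, then
`u(x) = ∫₁ˣ a` is `C¹`, vanishes on `(-∞,1]`, solves `u'(x) = a(x)·∫₀² u(s)a(s) ds`
everywhere, and `u(2) = √2 ≠ 0`. -/
theorem weak_UCP_fails_global_linear_perturbation
    (a : ℝ → ℝ) (ha : Continuous a) (ha0 : ∀ x : ℝ, x ≤ 1 → a x = 0)
    (hint : ∫ t in (1:ℝ)..2, a t = Real.sqrt 2)
    (u : ℝ → ℝ) (hu : ∀ x : ℝ, u x = ∫ t in (1:ℝ)..x, a t) :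
    ContDiff ℝ 1 u ∧
      (∀ x : ℝ, x ≤ 1 → u x = 0) ∧
      (∀ x : ℝ, deriv u x = a x * ∫ s in (0:ℝ)..2, u s * a s) ∧
      u 2 = Real.sqrt 2 ∧ u 2 ≠ 0 := by
  have hderiv (x : ℝ) : HasDerivAt u (a x) x := by
    rw [funext hu]
    exact ha.integral_hasStrictDerivAt 1 x |>.hasDerivAt
  have hcont : Continuous u := continuous_iff_continuousAt.2 fun x => (hderiv x).continuousAt
  have hzero (x : ℝ) (hx : x ≤ 1) : u x = 0 := by
    rw [hu, intervalIntegral.integral_symm, neg_eq_zero]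
    refine intervalIntegral.integral_zero_ae (.of_forall fun t ht => ha0 t ?_)
    rw [Set.uIoc_of_le hx] at ht
    exact ht.2
  have htwo : u 2 = Real.sqrt 2 := (hu 2).trans hint
  have hone : ∫ s in (0:ℝ)..2, u s * a s = 1 := by
    have hprim (s : ℝ) : HasDerivAt (fun y => u y ^ 2 / 2) (u s * a s) s :=
      (((hderiv s).pow 2).div_const 2).congr_deriv (by norm_num; ring)
    rw [intervalIntegral.integral_eq_sub_of_hasDerivAt (fun s _ => hprim s)
      ((hcont.mul ha).intervalIntegrable 0 2), htwo, hzero 0 zero_le_one,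
      Real.sq_sqrt zero_le_two]
    norm_num
  refine ⟨contDiff_one_iff_deriv.2 ⟨fun x => (hderiv x).differentiableAt, ?_⟩, hzero,
    fun x => by rw [hone, mul_one, (hderiv x).deriv], htwo, ?_⟩
  · rwa [funext fun x => (hderiv x).deriv]
  · rw [htwo]
    positivity
end
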